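/- Assume that κ = 1, or that κ ≥ 2 and Δτ μ² < 1/4. Then there exists a constant C > 0, depending only on μ and T, such that for every θ ∈ [0, 1/8): ( ∑_{k=1}^∞ λ_k² · ∑_{ℓ=1}^M Δτ · ( (1 + Δτ μ_k)^{-ℓ} − e^{-μ_k ℓ Δτ} )² )^{1/2} ≤ C · (1/8 − θ)^{-1} · Δτ^θ. -/

import Mathlib

noncomputable def lam (k : ℕ) : ℝ := (k : ℝ) * Real.pi

noncomputable def muK (μ : ℝ) (k : ℕ) : ℝ := lam k ^ 2 * (lam k ^ 2 - μ)

lemma aux_geom (z : ℝ) (hz : 0 < z) (M : ℕ) :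
    z * ∑ l ∈ Finset.Icc 1 M, ((1 + z) ^ l)⁻¹ + ((1 + z) ^ M)⁻¹ = 1 := by
  induction M with
  | zero => simp
  | succ n ih =>
    rw [Finset.sum_Icc_succ_top (by omega), mul_add]
    have : (1 + z) ≠ 0 := by positivity
    have e : z * ((1 + z) ^ (n + 1))⁻¹ + ((1 + z) ^ (n + 1))⁻¹ = ((1 + z) ^ n)⁻¹ := by
      field_simp
      ring
    linarith

lemma aux_diff (z : ℝ) (hz : 0 < z) (l : ℕ) :
    0 ≤ ((1 + z) ^ l)⁻¹ - Real.exp (-(z * l)) ∧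
    ((1 + z) ^ l)⁻¹ - Real.exp (-(z * l)) ≤ ((1 + z) ^ l)⁻¹ ∧
    ((1 + z) ^ l)⁻¹ - Real.exp (-(z * l)) ≤ z := by
  have hp : (0:ℝ) < (1 + z) ^ l := by positivity
  have hp1 : (1:ℝ) ≤ (1 + z) ^ l := one_le_pow₀ (by linarith)
  have hpi : ((1 + z) ^ l)⁻¹ ≤ 1 := inv_le_one_of_one_le₀ hp1
  have he : Real.exp (-(z * l)) = Real.exp (-z) ^ l := by
    rw [← Real.exp_nat_mul]; congr 1; ring
  have hepos := Real.exp_pos (-(z * l))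
  refine ⟨?_, by linarith, ?_⟩
  · rw [he, Real.exp_neg, ← inv_pow, sub_nonneg]
    have := Real.add_one_le_exp z
    gcongr
    linarith
  · rcases le_or_gt 1 z with h1 | h1
    · linarith
    · have h2 : (1 - z ^ 2) * (1 + z)⁻¹ ≤ Real.exp (-z) := by
        have := Real.add_one_le_exp (-z)
        have e : (1 - z ^ 2) * (1 + z)⁻¹ = 1 - z := by field_simp; ring
        rw [e]; linarith
      have h3 : (0:ℝ) ≤ (1 - z ^ 2) * (1 + z)⁻¹ := by
        have : 0 ≤ 1 - z ^ 2 := by nlinarith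
        positivity
      have h4 := pow_le_pow_left₀ h3 h2 l
      have h5 := one_add_mul_le_pow (a := -z ^ 2) (by nlinarith) l
      have h6 := one_add_mul_le_pow (a := z) (by linarith) l
      rw [he]
      rw [mul_pow, inv_pow] at h4
      have h7 : (1 + (l:ℝ) * -z ^ 2) * ((1 + z) ^ l)⁻¹ ≤ (1 - z ^ 2) ^ l * ((1 + z) ^ l)⁻¹ := by
        gcongr
        simpa [sub_eq_add_neg] using h5
      have h8 : (l : ℝ) * z * ((1 + z) ^ l)⁻¹ ≤ 1 := by
        rw [← div_eq_mul_inv, div_le_one hp]; linarith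
      nlinarith

lemma aux_sum (z : ℝ) (hz : 0 < z) (M : ℕ) :
    (∑ l ∈ Finset.Icc 1 M, (((1 + z) ^ l)⁻¹ - Real.exp (-(z * l))) ^ 2 ≤ 1) ∧
    z * (∑ l ∈ Finset.Icc 1 M, (((1 + z) ^ l)⁻¹ - Real.exp (-(z * l))) ^ 2) ≤ 1 := by
  have hg := aux_geom z hz M
  have hM : 0 < ((1 + z) ^ M)⁻¹ := by positivity
  constructor
  · refine le_trans ?_ (by linarith : z * ∑ l ∈ Finset.Icc 1 M, ((1 + z) ^ l)⁻¹ ≤ 1)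
    rw [Finset.mul_sum]
    apply Finset.sum_le_sum
    intro l _
    obtain ⟨h1, h2, h3⟩ := aux_diff z hz l
    rw [sq]
    exact mul_le_mul h3 h2 h1 hz.le
  · refine le_trans ?_ (by linarith : z * ∑ l ∈ Finset.Icc 1 M, ((1 + z) ^ l)⁻¹ ≤ 1)
    gcongr with l
    obtain ⟨h1, h2, h3⟩ := aux_diff z hz l
    have hp1 : (1:ℝ) ≤ (1 + z) ^ l := one_le_pow₀ (by linarith)
    have hpi : ((1 + z) ^ l)⁻¹ ≤ 1 := inv_le_one_of_one_le₀ hp1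
    nlinarith

lemma aux_w (c w S : ℝ) (hc : 0 < c) (hc1 : c ≤ 1) (hw : 0 < w) (hS : S ≤ 1)
    (hS0 : 0 ≤ S) (hS2 : c * w ^ 4 * S ≤ 1) : w ^ 2 * S ≤ 4 / c / (1 + w) ^ 2 := by
  rw [div_div, le_div_iff₀ (by positivity)]
  rcases le_or_gt w 1 with h | h
  · have h1 : w ^ 2 ≤ 1 := by nlinarith
    have h2 : (1 + w) ^ 2 ≤ 4 := by nlinarith
    have h3 : w ^ 2 * S ≤ 1 := by nlinarith
    have h4 : c * (1 + w) ^ 2 ≤ 4 := by nlinarith [sq_nonneg (1 + w)]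
    have : 0 ≤ c * (1 + w) ^ 2 := by positivity
    nlinarith
  · have h2 : (1 + w) ^ 2 ≤ 4 * w ^ 2 := by nlinarith
    calc w ^ 2 * S * (c * (1 + w) ^ 2) ≤ w ^ 2 * S * (c * (4 * w ^ 2)) := by gcongr
      _ = 4 * (c * w ^ 4 * S) := by ring
      _ ≤ 4 := by linarith

lemma aux_neg (y : ℝ) (hy0 : 0 ≤ y) (hy : y ≤ 1 / 2) (l : ℕ) :
    |((1 - y) ^ l)⁻¹ - Real.exp (y * l)| ≤
      Real.exp (y * l) * (2 * y ^ 2 * l * Real.exp (2 * y ^ 2 * l)) := by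
  have hp : (0:ℝ) < (1 - y) ^ l := pow_pos (by linarith) _
  have h1y : 0 < 1 - y := by linarith
  have he : Real.exp (y * l) = Real.exp y ^ l := by
    rw [← Real.exp_nat_mul]; congr 1; ring
  have lo : Real.exp (y * l) ≤ ((1 - y) ^ l)⁻¹ := by
    rw [he, ← inv_pow]
    gcongr
    rw [le_inv_comm₀ (Real.exp_pos _) h1y, ← Real.exp_neg]
    linarith [Real.add_one_le_exp (-y)]
  have up : ((1 - y) ^ l)⁻¹ ≤ Real.exp (y * l) * Real.exp (2 * y ^ 2 * l) := by
    rw [← Real.exp_add, ← inv_pow]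
    have : y * l + 2 * y ^ 2 * l = l * (y + 2 * y ^ 2) := by ring
    rw [this, Real.exp_nat_mul]
    gcongr
    rw [inv_le_iff_one_le_mul₀ h1y]
    have := Real.add_one_le_exp (y + 2 * y ^ 2)
    nlinarith [mul_le_mul_of_nonneg_right this h1y.le, mul_nonneg (sq_nonneg y) (by linarith : 0 ≤ 1 - 2 * y)]
  rw [abs_of_nonneg (by linarith)]
  set q := 2 * y ^ 2 * l with hq
  have h3 : Real.exp q - 1 ≤ q * Real.exp q := by
    have := Real.add_one_le_exp (-q)
    have h4 : Real.exp (-q) * Real.exp q = 1 := by rw [← Real.exp_add]; simp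
    nlinarith [Real.exp_pos q]
  have := Real.exp_pos (y * l)
  nlinarith

lemma aux_tele (t : ℝ) (ht : 0 < t) (n : ℕ) :
    ∑ k ∈ Finset.range n, t ^ 2 / (1 + ((k + 1 : ℕ) : ℝ) * t) ^ 2 ≤ t * (1 - (1 + n * t)⁻¹) := by
  induction n with
  | zero => simp
  | succ n ih =>
    rw [Finset.sum_range_succ]
    have h : t ^ 2 / (1 + ((n + 1 : ℕ) : ℝ) * t) ^ 2 ≤
        t * ((1 + n * t)⁻¹ - (1 + ((n + 1 : ℕ) : ℝ) * t)⁻¹) := by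
      push_cast
      have h1 : 0 < 1 + (n:ℝ) * t := by positivity
      have h2 : 0 < 1 + ((n:ℝ) + 1) * t := by positivity
      have e : t * ((1 + n * t)⁻¹ - (1 + ((n:ℝ) + 1) * t)⁻¹) =
        t ^ 2 / ((1 + ((n:ℝ) + 1) * t) * (1 + n * t)) := by
        field_simp; ring
      rw [e, sq (1 + ((n:ℝ) + 1) * t)]
      gcongr
      linarith
    linarith

lemma aux_pos_mode (μ c h t : ℝ) (M k : ℕ) (hk : 1 ≤ k) (hc : 0 < c) (hc1 : c ≤ 1)
    (ht : 0 < t) (hh : h = t ^ 4) (ha : c * lam k ^ 4 ≤ muK μ k) :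
    lam k ^ 2 * ∑ l ∈ Finset.Icc 1 M, h *
              ((1 + h * muK μ k) ^ (-(l : ℤ)) -
                  Real.exp (-(muK μ k) * ((l : ℝ) * h))) ^ 2
      ≤ 4 / c * (t ^ 2 / (1 + (k : ℝ) * t) ^ 2) := by
  have hk' : (1:ℝ) ≤ k := by exact_mod_cast hk
  have hl : (k:ℝ) ≤ lam k := by
    unfold lam; nlinarith [Real.pi_gt_three]
  have hlp : 0 < lam k := by linarith
  have hap : 0 < muK μ k := lt_of_lt_of_le (by positivity) ha
  have hhp : 0 < h := by rw [hh]; positivity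
  obtain ⟨s1, s2⟩ := aux_sum (h * muK μ k) (by positivity) M
  have e : ∑ l ∈ Finset.Icc 1 M, h *
              ((1 + h * muK μ k) ^ (-(l : ℤ)) -
                  Real.exp (-(muK μ k) * ((l : ℝ) * h))) ^ 2 =
      h * ∑ l ∈ Finset.Icc 1 M, (((1 + h * muK μ k) ^ l)⁻¹ - Real.exp (-(h * muK μ k * l))) ^ 2 := by
    rw [Finset.mul_sum]
    refine Finset.sum_congr rfl fun l _ => ?_
    rw [zpow_neg, zpow_natCast]
    congr 4
    ring
  rw [e]
  set S := ∑ l ∈ Finset.Icc 1 M, (((1 + h * muK μ k) ^ l)⁻¹ - Real.exp (-(h * muK μ k * l))) ^ 2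
  have hS0 : 0 ≤ S := Finset.sum_nonneg fun _ _ => sq_nonneg _
  have hw := aux_w c (lam k * t) S hc hc1 (by positivity) s1 hS0 (by
    refine le_trans ?_ s2
    refine mul_le_mul_of_nonneg_right ?_ hS0
    rw [hh]
    nlinarith [mul_le_mul_of_nonneg_left ha (pow_pos ht 4).le])
  calc lam k ^ 2 * (h * S) = t ^ 2 * ((lam k * t) ^ 2 * S) := by rw [hh]; ring
    _ ≤ t ^ 2 * (4 / c / (1 + lam k * t) ^ 2) := by gcongr
    _ ≤ t ^ 2 * (4 / c / (1 + k * t) ^ 2) := by gcongr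
    _ = _ := by ring

lemma aux_neg_mode (μ B h t T : ℝ) (M k κ : ℕ) (hk : k ≤ κ) (hB : 0 ≤ B)
    (ht : 0 < t) (hh : h = t ^ 4) (hhM : h * M = T) (htT : t ≤ 1 + T) (hT : 0 < T)
    (ha : muK μ k ≤ 0) (haB : - muK μ k ≤ B) (hBh : B * h ≤ 1 / 2) :
    lam k ^ 2 * ∑ l ∈ Finset.Icc 1 M, h *
              ((1 + h * muK μ k) ^ (-(l : ℤ)) -
                  Real.exp (-(muK μ k) * ((l : ℝ) * h))) ^ 2
      ≤ (lam κ ^ 2 * T * (Real.exp (B * T) * (2 * B ^ 2 * T * Real.exp (B * T))) ^ 2 * (1 + T) ^ 6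
          * (1 + κ * (1 + T)) ^ 2) * (t ^ 2 / (1 + (k : ℝ) * t) ^ 2) := by
  have hhp : 0 < h := by rw [hh]; positivity
  set D := Real.exp (B * T) * (2 * B ^ 2 * T * Real.exp (B * T)) with hD
  have hD0 : 0 ≤ D := by positivity
  set b := - muK μ k with hb
  have hb0 : 0 ≤ b := by linarith
  have hk' : (k:ℝ) ≤ κ := by exact_mod_cast hk
  have hl0 : 0 ≤ lam k := by unfold lam; positivity
  have hl : lam k ≤ lam κ := by unfold lam; gcongr
  have hyB : b * h ≤ B * h := by gcongr
  have term : ∀ l ∈ Finset.Icc 1 M, h * ((1 + h * muK μ k) ^ (-(l : ℤ)) -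
                  Real.exp (b * ((l : ℝ) * h))) ^ 2 ≤ h * (D * h) ^ 2 := by
    intro l hl
    have hlM : (l:ℝ) ≤ M := by exact_mod_cast (Finset.mem_Icc.1 hl).2
    have hlT : (l:ℝ) * h ≤ T := by rw [← hhM]; nlinarith
    have := aux_neg (b * h) (by positivity) (by linarith) l
    have e1 : (1 + h * muK μ k) ^ (-(l : ℤ)) = ((1 - b * h) ^ l)⁻¹ := by
      rw [zpow_neg, zpow_natCast, hb]; congr 2; ring
    have e2 : b * ((l : ℝ) * h) = b * h * l := by ring
    rw [e1, e2]
    refine mul_le_mul_of_nonneg_left ?_ hhp.le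
    rw [sq_le_sq, abs_of_nonneg (by positivity : 0 ≤ D * h)]
    refine this.trans ?_
    have g1 : b * h * l ≤ B * T := by
      calc b * h * l = b * (l * h) := by ring
        _ ≤ B * T := by gcongr
    have g2 : 2 * (b * h) ^ 2 * l ≤ 2 * B ^ 2 * T * h := by
      calc 2 * (b * h) ^ 2 * l = 2 * b ^ 2 * (l * h) * h := by ring
        _ ≤ 2 * B ^ 2 * T * h := by gcongr
    have g3 : 2 * (b * h) ^ 2 * l ≤ B * T := by
      refine g2.trans ?_
      have : 0 ≤ B * T := by positivity
      nlinarith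
    calc _ ≤ Real.exp (B * T) * (2 * B ^ 2 * T * h * Real.exp (B * T)) := by gcongr
      _ = D * h := by rw [hD]; ring
  have hsum := Finset.sum_le_sum term
  rw [Finset.sum_const, Nat.card_Icc, nsmul_eq_mul] at hsum
  have e3 : ((M + 1 - 1 : ℕ) : ℝ) * (h * (D * h) ^ 2) = T * D ^ 2 * (t ^ 6 * t ^ 2) := by
    rw [Nat.add_sub_cancel, ← hhM, hh]; ring
  rw [e3] at hsum
  have hq : (1 + (k:ℝ) * t) ^ 2 ≤ (1 + κ * (1 + T)) ^ 2 := by gcongr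
  have h1 : (1:ℝ) ≤ (1 + κ * (1 + T)) ^ 2 / (1 + (k:ℝ) * t) ^ 2 := by
    rw [le_div_iff₀ (by positivity)]; linarith
  calc _ ≤ lam k ^ 2 * (T * D ^ 2 * (t ^ 6 * t ^ 2)) := by gcongr
    _ ≤ lam κ ^ 2 * (T * D ^ 2 * ((1 + T) ^ 6 * t ^ 2)) := by gcongr
    _ ≤ lam κ ^ 2 * (T * D ^ 2 * ((1 + T) ^ 6 * t ^ 2)) * ((1 + κ * (1 + T)) ^ 2 / (1 + (k:ℝ) * t) ^ 2) :=
        le_mul_of_one_le_right (by positivity) h1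
    _ = _ := by ring

set_option maxHeartbeats 1000000 in
/-- Assume `κ = 1`, or `κ ≥ 2` and `Δτ μ² < 1/4` (with `Δτ = T/M`). Then there is `C > 0`,
depending only on `μ` and `T`, such that for every `θ ∈ [0, 1/8)`:
`(∑_k λ_k² ∑_{ℓ=1}^M Δτ ((1+Δτμ_k)^{-ℓ} − e^{-μ_k ℓΔτ})²)^{1/2} ≤ C (1/8 − θ)^{-1} Δτ^θ`. -/
theorem stmt_11 (μ : ℝ) (κ : ℕ) (hκ : 1 ≤ κ)
    (hμl : ((κ : ℝ) - 1) ^ 2 * Real.pi ^ 2 ≤ μ) (hμu : μ < (κ : ℝ) ^ 2 * Real.pi ^ 2)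
    (T : ℝ) (hT : 0 < T) :
    ∃ C > (0:ℝ), ∀ M : ℕ, 0 < M →
      (κ = 1 ∨ (2 ≤ κ ∧ (T / M) * μ ^ 2 < 1 / 4)) →
      ∀ θ : ℝ, 0 ≤ θ → θ < 1 / 8 →
        Real.sqrt (∑' k : ℕ, lam (k + 1) ^ 2 *
            ∑ l ∈ Finset.Icc 1 M, (T / M) *
              ((1 + (T / M) * muK μ (k + 1)) ^ (-(l : ℤ)) -
                  Real.exp (-(muK μ (k + 1)) * ((l : ℝ) * (T / M)))) ^ 2)
          ≤ C * (1 / 8 - θ)⁻¹ * (T / M) ^ θ := by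
  have hκ' : (1:ℝ) ≤ κ := by exact_mod_cast hκ
  have hμ0 : 0 ≤ μ := le_trans (by positivity) hμl
  have hpi := Real.pi_pos
  set c : ℝ := 1 - μ / ((κ:ℝ) ^ 2 * Real.pi ^ 2) with hcdef
  have hc : 0 < c := by
    rw [hcdef, sub_pos, div_lt_one (by positivity)]; exact hμu
  have hc1 : c ≤ 1 := by
    rw [hcdef]; linarith [div_nonneg hμ0 (by positivity : (0:ℝ) ≤ (κ:ℝ) ^ 2 * Real.pi ^ 2)]
  set B : ℝ := μ ^ 2 / 4 with hBdef
  have hB : 0 ≤ B := by positivity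
  set Cn : ℝ := (lam κ ^ 2 * T * (Real.exp (B * T) * (2 * B ^ 2 * T * Real.exp (B * T))) ^ 2 * (1 + T) ^ 6
          * (1 + κ * (1 + T)) ^ 2) with hCn
  have hCn0 : 0 ≤ Cn := by positivity
  set K : ℝ := 4 / c + Cn with hK
  have hK0 : 0 < K := by positivity
  refine ⟨Real.sqrt K * (1 + T), by positivity, ?_⟩
  intro M hM hcase θ hθ0 hθ1
  have hM' : (1:ℝ) ≤ M := by exact_mod_cast hM
  have hhM : T / M * M = T := by field_simp
  have hhT : T / M ≤ T := div_le_self hT.le hM'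
  have hhp : 0 < T / M := by positivity
  set h : ℝ := T / M with hh
  clear_value h
  set t : ℝ := h ^ (1 / 4 : ℝ) with htdef
  have ht : 0 < t := by positivity
  have ht4 : h = t ^ 4 := by
    rw [htdef, ← Real.rpow_natCast, ← Real.rpow_mul hhp.le]; norm_num
  have hpow : ∀ e : ℝ, 0 ≤ e → e ≤ 1 → h ^ e ≤ 1 + T := by
    intro e he0 he1
    calc h ^ e ≤ (1 + T) ^ e := Real.rpow_le_rpow hhp.le (by linarith) he0
      _ ≤ (1 + T) ^ (1:ℝ) := Real.rpow_le_rpow_of_exponent_le (by linarith) he1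
      _ = 1 + T := Real.rpow_one _
  have htT : t ≤ 1 + T := hpow _ (by norm_num) (by norm_num)
  have key : ∀ k : ℕ, lam (k + 1) ^ 2 * ∑ l ∈ Finset.Icc 1 M, h *
              ((1 + h * muK μ (k + 1)) ^ (-(l : ℤ)) -
                  Real.exp (-(muK μ (k + 1)) * ((l : ℝ) * h))) ^ 2
      ≤ K * (t ^ 2 / (1 + ((k + 1 : ℕ) : ℝ) * t) ^ 2) := by
    intro k
    have hq : 0 ≤ t ^ 2 / (1 + ((k + 1 : ℕ) : ℝ) * t) ^ 2 := by positivity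
    rcases le_or_gt κ (k + 1) with hk | hk
    · have ha : c * lam (k + 1) ^ 4 ≤ muK μ (k + 1) := by
        have hk' : (κ:ℝ) ≤ ((k + 1 : ℕ) : ℝ) := by exact_mod_cast hk
        have h1 : (κ:ℝ) ^ 2 * Real.pi ^ 2 ≤ lam (k + 1) ^ 2 := by
          unfold lam; rw [mul_pow]; gcongr
        have h2 : μ ≤ μ / ((κ:ℝ) ^ 2 * Real.pi ^ 2) * lam (k + 1) ^ 2 := by
          rw [div_mul_eq_mul_div, le_div_iff₀ (by positivity)]
          gcongr
        have h3 : c * lam (k + 1) ^ 2 ≤ lam (k + 1) ^ 2 - μ := by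
          rw [hcdef]; linarith
        unfold muK
        have h4 := mul_le_mul_of_nonneg_left h3 (sq_nonneg (lam (k + 1)))
        linear_combination h4
      refine (aux_pos_mode μ c h t M (k + 1) (by omega) hc hc1 ht ht4 ha).trans ?_
      gcongr
      linarith
    · have hk2 : 2 ≤ κ ∧ h * μ ^ 2 < 1 / 4 := by
        rcases hcase with h1 | h1
        · omega
        · exact h1
      have hk' : ((k + 1 : ℕ) : ℝ) ≤ (κ:ℝ) - 1 := by
        have : ((k + 1 : ℕ) : ℝ) + 1 ≤ κ := by exact_mod_cast hk
        linarith
      have h1 : lam (k + 1) ^ 2 ≤ μ := by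
        refine le_trans ?_ hμl
        unfold lam; rw [mul_pow]; gcongr
      refine (aux_neg_mode μ B h t T M (k + 1) κ hk.le hB ht ht4 hhM htT hT ?_ ?_ ?_).trans ?_
      · exact mul_nonpos_of_nonneg_of_nonpos (sq_nonneg _) (by linarith)
      · unfold muK
        rw [hBdef]
        have := sq_nonneg (lam (k + 1) ^ 2 - μ / 2)
        linear_combination this
      · rw [hBdef]; linarith
      · gcongr
        rw [hK]
        linarith [div_pos (by norm_num : (0:ℝ) < 4) hc]
  have hts : (∑' k : ℕ, lam (k + 1) ^ 2 * ∑ l ∈ Finset.Icc 1 M, h *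
              ((1 + h * muK μ (k + 1)) ^ (-(l : ℤ)) -
                  Real.exp (-(muK μ (k + 1)) * ((l : ℝ) * h))) ^ 2) ≤ K * t := by
    apply Real.tsum_le_of_sum_range_le
    · intro k
      positivity
    · intro n
      refine (Finset.sum_le_sum fun k _ => key k).trans ?_
      rw [← Finset.mul_sum]
      refine mul_le_mul_of_nonneg_left ?_ hK0.le
      refine (aux_tele t ht n).trans ?_
      have : 0 ≤ (1 + n * t)⁻¹ := by positivity
      nlinarith
  have hst : Real.sqrt t = h ^ (1 / 8 - θ) * h ^ θ := by
    rw [← Real.rpow_add hhp, Real.sqrt_eq_rpow, htdef, ← Real.rpow_mul hhp.le]; norm_num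
  have hinv : 1 ≤ (1 / 8 - θ)⁻¹ := by
    rw [one_le_inv₀ (by linarith)]; linarith
  calc _ ≤ Real.sqrt (K * t) := Real.sqrt_le_sqrt hts
    _ = Real.sqrt K * (h ^ (1 / 8 - θ) * 1 * h ^ θ) := by
      rw [Real.sqrt_mul hK0.le, hst]; ring
    _ ≤ Real.sqrt K * ((1 + T) * (1 / 8 - θ)⁻¹ * h ^ θ) := by
      gcongr
      exact hpow _ (by linarith) (by linarith)
    _ = _ := by ring
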